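/- For k, m ≥ 2, the rank (minimum size of a generating set) of the monoid POI_{k×m} equals 2k. -/

import Mathlib

noncomputable section

namespace POIPaper

instance pequivMonoid (α : Type*) : Monoid (α ≃. α) where
  one := PEquiv.refl α
  mul f g := f.trans g
  mul_assoc := PEquiv.trans_assoc
  one_mul := PEquiv.refl_trans
  mul_one := PEquiv.trans_refl

/-- `f` is `P`-stable for the ordered partition of `Ω` given by the block-index map `ι`. -/
def PStable {Ω : Type*} {k : ℕ} (ι : Ω → Fin k) (f : Ω ≃. Ω) : Prop :=
  ∀ x y : Ω, y ∈ f x →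
    (∀ z, ι z = ι x → (f z).isSome) ∧
    (∀ z w, w ∈ f z → ι z = ι x → ι w = ι y) ∧
    (∀ w, ι w = ι y → ∃ z, ι z = ι x ∧ w ∈ f z)

/-- `f` is `P`-order preserving for the ordered partition given by `ι`. -/
def POrdPres {Ω : Type*} {k : ℕ} (ι : Ω → Fin k) (f : Ω ≃. Ω) : Prop :=
  ∀ x y x' y' : Ω, x' ∈ f x → y' ∈ f y → ι x ≤ ι y → ι x' ≤ ι y'

/-- The set `POI(Ω,P)` of all `P`-stable and `P`-order preserving partial permutations. -/
def POISet {Ω : Type*} {k : ℕ} (ι : Ω → Fin k) : Set (Ω ≃. Ω) :=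
  {f | PStable ι f ∧ POrdPres ι f}

/-- Block index map of the uniform interval partition of `{1,...,km}` into `k` blocks of size `m`. -/
def blk (k m : ℕ) (a : Fin (k * m)) : Fin k :=
  ⟨(a : ℕ) / m, by
    have ha := a.isLt
    rcases Nat.eq_zero_or_pos m with h | h
    · subst h; simp at ha
    · rw [Nat.div_lt_iff_lt_mul h]; omega⟩

/-- The monoid `POI_{k×m}` (as a subset of the monoid of partial permutations). -/
def POIkm (k m : ℕ) : Set (Fin (k * m) ≃. Fin (k * m)) := POISet (blk k m)

/-- The cardinality of the image of a partial permutation. -/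
def imCard {n : ℕ} (f : Fin n ≃. Fin n) : ℕ := Set.ncard {b | (f.symm b).isSome}

/-- The `J`-preorder of the monoid `POI_{k×m}`: `α ≤_J β` iff `α ∈ M β M`. -/
def leJ (k m : ℕ) (α β : Fin (k * m) ≃. Fin (k * m)) : Prop :=
  ∃ s ∈ POIkm k m, ∃ t ∈ POIkm k m, α = s * β * t

/-- Order preserving partial permutations of a chain. -/
def OrdPres {n : ℕ} (f : Fin n ≃. Fin n) : Prop :=
  ∀ x y x' y' : Fin n, x' ∈ f x → y' ∈ f y → x ≤ y → x' ≤ y'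

/-- The group of units of `POI_{k×m}`: elements with full domain and image. -/
def unitsSet (k m : ℕ) : Set (Fin (k * m) ≃. Fin (k * m)) :=
  {f | f ∈ POIkm k m ∧ (∀ a, (f a).isSome) ∧ (∀ b, (f.symm b).isSome)}

open Equiv in
theorem finRotate_pow_self (n : ℕ) : (finRotate (n+1))^(n+1) = 1 := by
  rcases n with _ | n
  · ext x
    exact congrArg _ (Subsingleton.elim (α := Fin 1) _ _)
  · have := (isCycle_finRotate (n := n)).orderOf
    rw [support_finRotate] at this
    simp at this
    have h := pow_orderOf_eq_one (finRotate (n+2))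
    rwa [this] at h

open Equiv in
theorem exists_gen (m : ℕ) (hm : 2 ≤ m) : ∃ t c : Perm (Fin m), ∃ N : ℕ,
    Odd N ∧ t^2 = 1 ∧ c^N = 1 ∧ Submonoid.closure {t, c} = ⊤ := by
  obtain ⟨n, rfl⟩ : ∃ n, m = n + 2 := ⟨m - 2, by omega⟩
  have hcl := Equiv.Perm.closure_cycle_adjacent_swap (isCycle_finRotate (n := n))
    support_finRotate 0
  have h01 : finRotate (n+2) 0 = 1 := by simp
  rw [h01] at hcl
  have hsw : (swap (0 : Fin (n+2)) 1)^2 = 1 := by rw [pow_two, swap_mul_self]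
  rcases Nat.even_or_odd n with h | h
  · refine ⟨swap 0 1, swap 0 1 * finRotate (n+2), n+1, h.add_one, hsw, ?_, ?_⟩
    · have hc : swap 0 1 * finRotate (n+2) = Perm.decomposeFin.symm (0, finRotate (n+1)) := by
        rw [finRotate_succ_eq_decomposeFin]
        ext x
        refine Fin.cases ?_ (fun y => ?_) x
        · simp
        · simp [Perm.decomposeFin_symm_apply_succ]
      rw [hc]
      have key : ∀ j : ℕ, ((Perm.decomposeFin.symm (0, finRotate (n+1)))^j) 0 = 0 ∧
          ∀ x : Fin (n+1), ((Perm.decomposeFin.symm (0, finRotate (n+1)))^j) x.succ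
            = (((finRotate (n+1))^j) x).succ := by
        intro j
        induction j with
        | zero => simp
        | succ j ih =>
          refine ⟨?_, fun x => ?_⟩
          · rw [pow_succ', Perm.mul_apply, ih.1]; simp
          · rw [pow_succ', Perm.mul_apply, ih.2, pow_succ', Perm.mul_apply]
            simp [Perm.decomposeFin_symm_apply_succ]
      refine Equiv.ext fun x => ?_
      refine Fin.cases ?_ (fun y => ?_) x
      · rw [(key _).1]; rfl
      · rw [(key _).2, finRotate_pow_self]; rfl
    · rw [← Subgroup.closure_toSubmonoid_of_finite]
      rw [← Subgroup.top_toSubmonoid, Subgroup.toSubmonoid_inj, eq_top_iff, ← hcl,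
        Subgroup.closure_le]
      have h1 : swap (0 : Fin (n+2)) 1 ∈ Subgroup.closure
        {swap (0 : Fin (n+2)) 1, swap 0 1 * finRotate (n+2)} := Subgroup.subset_closure (by simp)
      have h2 : swap (0 : Fin (n+2)) 1 * finRotate (n+2) ∈ Subgroup.closure
        {swap (0 : Fin (n+2)) 1, swap 0 1 * finRotate (n+2)} := Subgroup.subset_closure (by simp)
      rintro x (rfl | rfl)
      · have := mul_mem h1 h2
        rwa [swap_mul_self_mul] at this
      · exact h1
  · refine ⟨swap 0 1, finRotate (n+2), n+2, by grind, hsw, finRotate_pow_self _, ?_⟩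
    rw [← Subgroup.closure_toSubmonoid_of_finite, Set.pair_comm, hcl]
    rfl

/-- direct power generated by k elements -/
theorem exists_gen_pi (k m : ℕ) (hk : 2 ≤ k) (hm : 2 ≤ m) :
    ∃ g : Fin k → (Fin k → Equiv.Perm (Fin m)), Submonoid.closure (Set.range g) = ⊤ := by
  obtain ⟨t, c, N, hN, ht, hc, htc⟩ := exists_gen m hm
  obtain ⟨n, rfl⟩ : ∃ n, k = n + 2 := ⟨k - 2, by omega⟩
  refine ⟨fun i => Pi.mulSingle i t * Pi.mulSingle (i+1) c, ?_⟩
  set C := Submonoid.closure (Set.range fun i : Fin (n+2) =>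
    (Pi.mulSingle i t * Pi.mulSingle (i+1) c : Fin (n+2) → Equiv.Perm (Fin m))) with hC
  have hne : ∀ i : Fin (n+2), i ≠ i + 1 := by intro i; simp
  have hcomm : ∀ i : Fin (n+2), Commute (Pi.mulSingle i t : Fin (n+2) → Equiv.Perm (Fin m))
      (Pi.mulSingle (i+1) c) := fun i => Pi.mulSingle_commute (f := fun _ => Equiv.Perm (Fin m)) (hne i) t c
  have hg : ∀ i : Fin (n+2), (Pi.mulSingle i t * Pi.mulSingle (i+1) c : Fin (n+2) → _) ∈ C :=
    fun i => Submonoid.subset_closure ⟨i, rfl⟩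
  have hp : ∀ (i : Fin (n+2)) (e : ℕ), (Pi.mulSingle i (t^e) * Pi.mulSingle (i+1) (c^e) :
      Fin (n+2) → _) ∈ C := by
    intro i e
    have := pow_mem (hg i) e
    rwa [(hcomm i).mul_pow, ← Pi.mulSingle_pow, ← Pi.mulSingle_pow] at this
  have htm : ∀ i : Fin (n+2), Pi.mulSingle i t ∈ C := by
    intro i
    have := hp i N
    obtain ⟨r, rfl⟩ := hN
    rw [hc, pow_succ, pow_mul, ht] at this
    simpa using this
  have hcm : ∀ i : Fin (n+2), Pi.mulSingle (i+1) c ∈ C := by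
    intro i
    have := hp i (N+1)
    obtain ⟨r, rfl⟩ := hN
    rw [pow_succ c, hc, show 2 * r + 1 + 1 = 2 * (r+1) by ring, pow_mul, ht] at this
    simpa using this
  rw [eq_top_iff]
  intro x _
  refine Submonoid.pi_mem_of_mulSingle_mem x fun i => ?_
  have : Submonoid.closure {t, c} ≤ C.comap (MonoidHom.mulSingle _ i) := by
    rw [Submonoid.closure_le]
    rintro y (rfl | rfl)
    · exact htm i
    · have := hcm (i - 1)
      rw [sub_add_cancel] at this
      exact this
  rw [htc] at this
  exact this (Submonoid.mem_top (x i))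

theorem card_le_of_gen (k m : ℕ) (hm : 2 ≤ m) (T : Set (Fin k → Equiv.Perm (Fin m)))
    (hT : Submonoid.closure T = ⊤) : k ≤ T.ncard := by
  classical
  let S : (Fin k → Equiv.Perm (Fin m)) →* (Fin k → ℤˣ) :=
    { toFun := fun s i => Equiv.Perm.sign (s i)
      map_one' := by ext; simp
      map_mul' := by intros; ext; simp }
  have hS : Function.Surjective S := by
    have : Nontrivial (Fin m) := Fin.nontrivial_iff_two_le.2 hm
    intro e
    choose s hs using fun i => Equiv.Perm.sign_surjective (Fin m) (e i)
    exact ⟨s, funext hs⟩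
  have hfin : T.Finite := Set.toFinite _
  have h1 : Submonoid.closure (S '' T) = ⊤ := by
    rw [← MonoidHom.map_mclosure, hT, ← MonoidHom.mrange_eq_map]
    exact MonoidHom.mrange_eq_top.2 hS
  obtain ⟨F, hF⟩ := (Set.toFinite (S '' T)).exists_finset_coe
  rw [← hF] at h1
  have h2 : Function.Surjective (fun b : F → Fin 2 => ∏ a : F, (a : Fin k → ℤˣ) ^ (b a : ℕ)) := by
    intro x
    have hx : x ∈ Submonoid.closure (F : Set (Fin k → ℤˣ)) := by rw [h1]; trivial
    obtain ⟨f, -, rfl⟩ := Submonoid.mem_closure_finset.1 hx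
    refine ⟨fun a => ⟨f a % 2, Nat.mod_lt _ (by norm_num)⟩, ?_⟩
    rw [← Finset.prod_coe_sort]
    refine Finset.prod_congr rfl fun a _ => ?_
    have ha : (a : Fin k → ℤˣ)^2 = 1 := by ext i; simp
    conv_rhs => rw [← Nat.mod_add_div (f a) 2, pow_add, pow_mul, ha, one_pow, mul_one]
  have h3 := Fintype.card_le_of_surjective _ h2
  simp at h3
  have h4 : F.card ≤ T.ncard := by
    rw [← Set.ncard_coe_finset, hF]
    exact Set.ncard_image_le hfin
  exact le_trans ((Nat.pow_le_pow_iff_right (by norm_num)).1 h3) h4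

theorem pext {α β : Type*} {f g : α ≃. β} (h : ∀ x y, f x = some y ↔ g x = some y) : f = g :=
  PEquiv.ext fun x => Option.ext fun y => h x y

theorem mul_eq_some {α : Type*} (f g : α ≃. α) (a c : α) :
    (f * g) a = some c ↔ ∃ b, f a = some b ∧ g b = some c :=
  PEquiv.trans_eq_some f g a c

theorem one_eq_some {α : Type*} (a c : α) : (1 : α ≃. α) a = some c ↔ a = c := by
  change (PEquiv.refl α) a = some c ↔ _
  simp

theorem symm_mul {α : Type*} (f g : α ≃. α) : (f * g).symm = g.symm * f.symm := by
  apply pext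
  intro x y
  rw [PEquiv.eq_some_iff, mul_eq_some, mul_eq_some]
  simp only [PEquiv.eq_some_iff]
  constructor <;> rintro ⟨b, h1, h2⟩ <;> exact ⟨b, h2, h1⟩

theorem pinj {α β : Type*} (f : α ≃. β) {a b : α} {c : β} (h1 : f a = some c)
    (h2 : f b = some c) : a = b := f.inj h1 h2

def alp {K : ℕ} (i j : Fin (K+1)) : Fin (K+1) ≃. Fin (K+1) where
  toFun l := (finSuccEquiv' i l).map j.succAbove
  invFun l := (finSuccEquiv' j l).map i.succAbove
  inv a b := by
    simp only [Option.map_eq_some_iff, finSuccEquiv'_eq_some]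
    constructor <;> rintro ⟨p, h1, h2⟩ <;> exact ⟨p, h2.symm, h1.symm⟩

theorem alp_eq {K : ℕ} (i j l l' : Fin (K+1)) :
    alp i j l = some l' ↔ ∃ p, l = i.succAbove p ∧ l' = j.succAbove p := by
  change (finSuccEquiv' i l).map j.succAbove = some l' ↔ _
  simp only [Option.map_eq_some_iff, finSuccEquiv'_eq_some]
  constructor <;> rintro ⟨p, h1, h2⟩ <;> exact ⟨p, h1, h2.symm⟩

theorem alp_mul {K : ℕ} (i j l : Fin (K+1)) : alp i j * alp j l = alp i l := by
  apply pext
  intro x y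
  simp only [mul_eq_some, alp_eq]
  constructor
  · rintro ⟨b, ⟨p, rfl, rfl⟩, ⟨q, hq, rfl⟩⟩
    have := Fin.succAbove_right_injective hq
    subst this
    exact ⟨p, rfl, rfl⟩
  · rintro ⟨p, rfl, rfl⟩
    exact ⟨_, ⟨p, rfl, rfl⟩, ⟨p, rfl, rfl⟩⟩

theorem alp_symm {K : ℕ} (i j : Fin (K+1)) : (alp i j).symm = alp j i := rfl

theorem alp_self {K : ℕ} (i x y : Fin (K+1)) : alp i i x = some y ↔ x ≠ i ∧ x = y := by
  rw [alp_eq]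
  constructor
  · rintro ⟨p, rfl, rfl⟩
    exact ⟨Fin.succAbove_ne _ _, rfl⟩
  · rintro ⟨h, rfl⟩
    obtain ⟨p, hp⟩ := Fin.exists_succAbove_eq h
    exact ⟨p, hp.symm, hp.symm⟩

theorem alp_swap {K : ℕ} (i : Fin K) (x y : Fin (K+1)) :
    alp i.succ i.castSucc x = some y ↔ x ≠ i.succ ∧ y = Equiv.swap i.castSucc i.succ x := by
  have key : ∀ p, i.castSucc.succAbove p = Equiv.swap i.castSucc i.succ (i.succ.succAbove p) := by
    intro p
    rcases lt_trichotomy p i with h | h | h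
    · rw [Fin.succAbove_of_castSucc_lt _ _ (by simpa using h),
        Fin.succAbove_of_castSucc_lt _ _ (by rw [Fin.lt_def] at *; simp; omega), Equiv.swap_apply_of_ne_of_ne]
      · simpa using h.ne
      · rw [Fin.lt_def] at h; simp [Fin.ext_iff]; omega
    · subst h
      simp
    · rw [Fin.succAbove_of_le_castSucc _ _ (by simpa using h.le),
        Fin.succAbove_of_le_castSucc _ _ (by rw [Fin.lt_def] at h; rw [Fin.le_def]; simp; omega), Equiv.swap_apply_of_ne_of_ne]
      · rw [Fin.lt_def] at h; simp [Fin.ext_iff]; omega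
      · simpa using h.ne'
  rw [alp_eq]
  constructor
  · rintro ⟨p, rfl, rfl⟩
    exact ⟨Fin.succAbove_ne _ _, key p⟩
  · rintro ⟨h, rfl⟩
    obtain ⟨p, hp⟩ := Fin.exists_succAbove_eq h
    exact ⟨p, hp.symm, by rw [key, hp]⟩

def OP {n : ℕ} (f : Fin n ≃. Fin n) : Prop :=
  ∀ x y x' y' : Fin n, f x = some x' → f y = some y' → x ≤ y → x' ≤ y'

theorem OP.symm {n : ℕ} {f : Fin n ≃. Fin n} (h : OP f) : OP f.symm := by
  intro x y x' y' hx hy hxy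
  rw [PEquiv.eq_some_iff] at hx hy
  by_contra hc
  push Not at hc
  have := h _ _ _ _ hy hx hc.le
  have e : x = y := le_antisymm hxy this
  subst e
  exact hc.ne' (pinj f hx hy)

theorem OP.mul {n : ℕ} {f g : Fin n ≃. Fin n} (hf : OP f) (hg : OP g) : OP (f * g) := by
  intro x y x' y' hx hy hxy
  rw [mul_eq_some] at hx hy
  obtain ⟨a, ha, ha'⟩ := hx
  obtain ⟨b, hb, hb'⟩ := hy
  exact hg _ _ _ _ ha' hb' (hf _ _ _ _ ha hb hxy)

theorem OP_alp {K : ℕ} (i j : Fin (K+1)) : OP (alp i j) := by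
  intro x y x' y' hx hy hxy
  rw [alp_eq] at hx hy
  obtain ⟨p, rfl, rfl⟩ := hx
  obtain ⟨q, rfl, rfl⟩ := hy
  rw [Fin.succAbove_le_succAbove_iff] at *
  exact hxy

def Ini {K : ℕ} (f : Fin (K+1) ≃. Fin (K+1)) : Prop :=
  ∀ i : Fin K, (f i.succ).isSome → (f i.castSucc).isSome

theorem Ini.down {K : ℕ} {f : Fin (K+1) ≃. Fin (K+1)} (h : Ini f) (b : Fin (K+1)) :
    (f b).isSome → ∀ a ≤ b, (f a).isSome := by
  induction b using Fin.induction with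
  | zero => intro h0 a ha; rwa [Fin.le_zero_iff.1 ha]
  | succ i ih =>
    intro hb a ha
    rcases ha.eq_or_lt with e | e
    · rwa [e]
    · exact ih (h i hb) a (Fin.le_castSucc_iff.2 e)

theorem ini_id {K : ℕ} {f : Fin (K+1) ≃. Fin (K+1)} (hf : OP f) (h1 : Ini f) (h2 : Ini f.symm) :
    ∀ l j, f l = some j → j = l := by
  intro l
  induction l using WellFoundedLT.induction with
  | ind l ih =>
  intro j hj
  rcases lt_trichotomy j l with h | h | h
  · obtain ⟨y, hy⟩ := Option.isSome_iff_exists.1 (h1.down l (by simp [hj]) j h.le)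
    have := ih j h y hy
    subst this
    exact absurd (pinj f hy hj) h.ne
  · exact h
  · obtain ⟨p, hp⟩ := Option.isSome_iff_exists.1
      (h2.down j (by rw [(PEquiv.eq_some_iff f).2 hj]; rfl) l h.le)
    rw [PEquiv.eq_some_iff] at hp
    rcases lt_or_ge p l with h' | h'
    · exact absurd (ih p h' _ hp) h'.ne'
    · exact absurd (hf _ _ _ _ hj hp h') (not_le.2 h)

def dsum {K : ℕ} (f : Fin (K+1) ≃. Fin (K+1)) : ℕ := ∑ l, if (f l).isSome then (l : ℕ) else 0

theorem step {K : ℕ} (f : Fin (K+1) ≃. Fin (K+1)) (i : Fin K) (h0 : f i.castSucc = none)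
    (h1 : (f i.succ).isSome) :
    f = alp i.castSucc i.succ * (alp i.succ i.castSucc * f) ∧
    dsum (alp i.succ i.castSucc * f) < dsum f ∧
    dsum (alp i.succ i.castSucc * f).symm = dsum f.symm := by
  have hsw : ∀ x, (alp i.succ i.castSucc * f) x = f (Equiv.swap i.castSucc i.succ x) := by
    intro x
    refine Option.ext fun y => ?_
    rw [mul_eq_some]
    simp only [alp_swap]
    constructor
    · rintro ⟨b, ⟨_, rfl⟩, h⟩; exact h
    · intro h
      refine ⟨_, ⟨?_, rfl⟩, h⟩
      rintro rfl
      rw [Equiv.swap_apply_right, h0] at h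
      cases h
  refine ⟨?_, ?_, ?_⟩
  · rw [← mul_assoc, alp_mul]
    apply pext
    intro x y
    rw [mul_eq_some]
    simp only [alp_self]
    constructor
    · intro h
      refine ⟨x, ⟨?_, rfl⟩, h⟩
      rintro rfl
      rw [h0] at h; cases h
    · rintro ⟨b, ⟨_, rfl⟩, h⟩; exact h
  · unfold dsum
    simp only [hsw]
    rw [← Equiv.sum_comp (Equiv.swap i.castSucc i.succ)]
    simp only [Equiv.swap_apply_self]
    apply Finset.sum_lt_sum
    · intro l _
      split_ifs with h
      · by_cases e : l = i.succ
        · subst e; simp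
        · rw [Equiv.swap_apply_of_ne_of_ne _ e]
          rintro rfl; rw [h0] at h; cases h
      · exact le_rfl
    · exact ⟨i.succ, Finset.mem_univ _, by simp [h1]⟩
  · unfold dsum
    refine Finset.sum_congr rfl fun l _ => ?_
    have : ((alp i.succ i.castSucc * f).symm l).isSome ↔ (f.symm l).isSome := by
      simp only [Option.isSome_iff_exists, PEquiv.eq_some_iff, hsw]
      constructor
      · rintro ⟨a, h⟩; exact ⟨_, h⟩
      · rintro ⟨a, h⟩; exact ⟨Equiv.swap i.castSucc i.succ a, by simpa using h⟩
    simp only [this]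

theorem all_in {K : ℕ} (C : Submonoid (Fin (K+1) ≃. Fin (K+1))) (hC : ∀ i j, alp i j ∈ C) :
    ∀ (n : ℕ) (f : Fin (K+1) ≃. Fin (K+1)), OP f → dsum f + dsum f.symm ≤ n →
      f ∈ C ∧ f.symm ∈ C := by
  have hid : ∀ f : Fin (K+1) ≃. Fin (K+1), (∀ l j, f l = some j → j = l) → f ∈ C := by
    classical
    have hA : ∀ A : Finset (Fin (K+1)), PEquiv.ofSet {x | x ∉ A} ∈ C := by
      intro A
      induction A using Finset.induction_on with
      | empty =>
        convert C.one_mem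
        apply pext
        intro x y
        rw [one_eq_some]
        simp [PEquiv.ofSet_eq_some_iff, eq_comm]
      | insert a A ha ih =>
        convert C.mul_mem (hC a a) ih using 1
        apply pext
        intro x y
        rw [mul_eq_some]
        simp only [alp_self, PEquiv.ofSet_eq_some_iff, Set.mem_ofPred_eq, Finset.mem_insert, not_or]
        constructor
        · rintro ⟨rfl, h1, h2⟩; exact ⟨y, ⟨h1, rfl⟩, rfl, h2⟩
        · rintro ⟨b, ⟨h1, rfl⟩, rfl, h2⟩; exact ⟨rfl, h1, h2⟩
    intro f hf
    convert hA (Finset.univ.filter fun x => f x = none)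
    apply pext
    intro x y
    simp only [PEquiv.ofSet_eq_some_iff, Set.mem_ofPred_eq, Finset.mem_filter, Finset.mem_univ,
      true_and]
    constructor
    · intro h
      have := hf _ _ h
      subst this
      exact ⟨rfl, by simp [h]⟩
    · rintro ⟨rfl, h⟩
      obtain ⟨z, hz⟩ := Option.ne_none_iff_exists'.1 h
      rw [hz, hf _ _ hz]
  intro n
  induction n using Nat.strong_induction_on with
  | _ n ih =>
  have main : ∀ f : Fin (K+1) ≃. Fin (K+1), OP f → dsum f + dsum f.symm ≤ n → ¬ Ini f →
      f ∈ C ∧ f.symm ∈ C := by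
    intro f hf hn hi
    unfold Ini at hi
    push Not at hi
    obtain ⟨i, h1, h0⟩ := hi
    simp at h0
    obtain ⟨e, l1, l2⟩ := step f i h0 h1
    obtain ⟨a, b⟩ := ih _ (by omega) (alp i.succ i.castSucc * f) ((OP_alp _ _).mul hf) le_rfl
    rw [e]
    refine ⟨C.mul_mem (hC _ _) a, ?_⟩
    rw [symm_mul, alp_symm]
    exact C.mul_mem b (hC _ _)
  intro f hf hn
  by_cases h1 : Ini f
  · by_cases h2 : Ini f.symm
    · have h := ini_id hf h1 h2
      refine ⟨hid f h, hid _ fun l j hl => ?_⟩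
      rw [PEquiv.eq_some_iff] at hl
      exact (h _ _ hl).symm
    · have := main f.symm hf.symm (by rw [PEquiv.symm_symm]; omega) h2
      rw [PEquiv.symm_symm] at this
      exact this.symm
  · exact main f hf hn h1

theorem OP_mem {K : ℕ} (C : Submonoid (Fin (K+1) ≃. Fin (K+1))) (hC : ∀ i, alp i (i+1) ∈ C)
    (f : Fin (K+1) ≃. Fin (K+1)) (hf : OP f) : f ∈ C := by
  refine (all_in C ?_ _ f hf le_rfl).1
  intro i
  have up : ∀ b : Fin (K+1), alp i b ∈ C → ∀ c, b ≤ c → alp i c ∈ C := by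
    intro b hb c
    induction c using Fin.induction with
    | zero => intro h; rwa [← Fin.le_zero_iff.1 h]
    | succ c ih =>
      intro h
      rcases h.eq_or_lt with e | e
      · rwa [← e]
      · have := C.mul_mem (ih (Fin.le_castSucc_iff.2 e)) (hC c.castSucc)
        rwa [alp_mul, Fin.coeSucc_eq_succ] at this
  have hl := C.mul_mem (up _ (hC i) (Fin.last K) (Fin.le_last _)) (hC (Fin.last K))
  rw [alp_mul, Fin.last_add_one] at hl
  exact fun j => up 0 hl j (Fin.zero_le _)

theorem OP_total {K : ℕ} {f : Fin K ≃. Fin K} (hf : OP f) (h : ∀ i, (f i).isSome) : f = 1 := by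
  choose g hg using fun i => Option.isSome_iff_exists.1 (h i)
  have hm : StrictMono g := by
    intro a b hab
    refine lt_of_le_of_ne (hf _ _ _ _ (hg a) (hg b) hab.le) fun e => hab.ne ?_
    exact pinj f (hg a) (by rw [hg b, e])
  have hid : g = id := by
    have hb : Function.Bijective g := Finite.injective_iff_bijective.1 hm.injective
    exact (hm.range_inj strictMono_id).1 (by rw [hb.surjective.range_eq]; simp)
  apply pext
  intro x y
  rw [one_eq_some, hg, hid]
  simp

def Uu {k m : ℕ} : (Fin k → Equiv.Perm (Fin m)) →* (Fin k × Fin m ≃. Fin k × Fin m) where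
  toFun s :=
    { toFun := fun p => some (p.1, (s p.1)⁻¹ p.2)
      invFun := fun p => some (p.1, s p.1 p.2)
      inv := by
        rintro ⟨a, b⟩ ⟨c, d⟩
        simp only [Option.some.injEq, Prod.mk.injEq]
        constructor
        · rintro ⟨rfl, rfl⟩; simp
        · rintro ⟨rfl, rfl⟩; simp }
  map_one' := by
    apply pext
    intro x y
    rw [one_eq_some]
    change some _ = some _ ↔ _
    simp
  map_mul' s t := by
    apply pext
    intro x y
    rw [mul_eq_some]
    change some _ = some _ ↔ ∃ b, some _ = some _ ∧ some _ = some _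
    simp

theorem Uu_apply {k m : ℕ} (s : Fin k → Equiv.Perm (Fin m)) (p : Fin k × Fin m) :
    Uu s p = some (p.1, (s p.1)⁻¹ p.2) := rfl

theorem Uu_symm_apply {k m : ℕ} (s : Fin k → Equiv.Perm (Fin m)) (p : Fin k × Fin m) :
    (Uu s).symm p = some (p.1, s p.1 p.2) := rfl

theorem Uu_inj {k m : ℕ} : Function.Injective (Uu (k := k) (m := m)) := by
  intro s t h
  funext i
  refine Equiv.ext fun x => ?_
  have h' : (Uu s).symm (i, x) = (Uu t).symm (i, x) := by rw [h]
  rw [Uu_symm_apply, Uu_symm_apply] at h'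
  simpa using h'

def Ll {k m : ℕ} : (Fin k ≃. Fin k) →* (Fin k × Fin m ≃. Fin k × Fin m) where
  toFun f :=
    { toFun := fun p => (f p.1).map fun j => (j, p.2)
      invFun := fun p => (f.symm p.1).map fun j => (j, p.2)
      inv := by
        rintro ⟨a, b⟩ ⟨c, d⟩
        simp only [Option.map_eq_some_iff, Prod.mk.injEq, PEquiv.eq_some_iff]
        constructor
        · rintro ⟨x, h, rfl, rfl⟩; exact ⟨_, h, rfl, rfl⟩
        · rintro ⟨x, h, rfl, rfl⟩; exact ⟨_, h, rfl, rfl⟩ }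
  map_one' := by
    apply pext
    rintro ⟨a, b⟩ ⟨c, d⟩
    rw [one_eq_some]
    change Option.map (fun j => (j, b)) ((1 : Fin k ≃. Fin k) a) = some (c, d) ↔ _
    simp [Option.map_eq_some_iff, one_eq_some]
  map_mul' s t := by
    apply pext
    rintro ⟨a, b⟩ ⟨c, d⟩
    rw [mul_eq_some]
    change Option.map _ _ = some _ ↔ ∃ b, Option.map _ _ = some _ ∧ Option.map _ _ = some _
    simp only [Option.map_eq_some_iff, mul_eq_some, Prod.mk.injEq, Prod.exists]
    constructor
    · rintro ⟨x, ⟨y, h1, h2⟩, rfl, rfl⟩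
      exact ⟨y, b, ⟨y, h1, rfl, rfl⟩, ⟨_, h2, rfl, rfl⟩⟩
    · rintro ⟨y, b', ⟨_, h1, rfl, rfl⟩, ⟨_, h2, rfl, rfl⟩⟩
      exact ⟨_, ⟨_, h1, h2⟩, rfl, rfl⟩

theorem Ll_eq {k m : ℕ} (f : Fin k ≃. Fin k) (p q : Fin k × Fin m) :
    Ll f p = some q ↔ f p.1 = some q.1 ∧ q.2 = p.2 := by
  change Option.map _ _ = some _ ↔ _
  rw [Option.map_eq_some_iff]
  constructor
  · rintro ⟨a, h, rfl⟩; exact ⟨h, rfl⟩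
  · rintro ⟨h, h2⟩; exact ⟨_, h, Prod.ext rfl h2.symm⟩

abbrev PP (k m : ℕ) : Set (Fin k × Fin m ≃. Fin k × Fin m) :=
  POISet (fun p : Fin k × Fin m => p.1)

theorem Uu_mem {k m : ℕ} (s : Fin k → Equiv.Perm (Fin m)) : Uu s ∈ PP k m := by
  constructor
  · rintro ⟨a, b⟩ ⟨c, d⟩ h
    change Uu s _ = some _ at h
    rw [Uu_apply] at h
    simp only [Option.some.injEq, Prod.mk.injEq] at h
    obtain ⟨rfl, rfl⟩ := h
    refine ⟨fun _ _ => rfl, ?_, ?_⟩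
    · rintro ⟨a', b'⟩ ⟨c', d'⟩ h rfl
      change Uu s _ = some _ at h
      rw [Uu_apply] at h
      simp only [Option.some.injEq, Prod.mk.injEq] at h
      exact h.1.symm
    · rintro ⟨a', b'⟩ rfl
      refine ⟨(a', s a' b'), rfl, ?_⟩
      change Uu s _ = some _
      simp [Uu_apply]
  · rintro ⟨a, b⟩ ⟨c, d⟩ x y h1 h2 h
    change Uu s _ = some _ at h1 h2
    rw [Uu_apply] at h1 h2
    cases h1; cases h2
    exact h

theorem Ll_mem {k m : ℕ} (f : Fin k ≃. Fin k) (hf : OP f) : Ll f ∈ PP k m := by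
  constructor
  · intro x y h
    change Ll f _ = some _ at h
    rw [Ll_eq] at h
    refine ⟨?_, ?_, ?_⟩
    · intro z hz
      have : Ll f z = some (y.1, z.2) := by
        rw [Ll_eq]
        exact ⟨by rw [← h.1]; exact congrArg _ hz, rfl⟩
      rw [this]; rfl
    · intro z w hw hz
      change Ll f _ = some _ at hw
      rw [Ll_eq] at hw
      have hz' : z.1 = x.1 := hz
      rw [hz', h.1] at hw
      exact (Option.some.inj hw.1).symm
    · intro w hw
      refine ⟨(x.1, w.2), rfl, ?_⟩
      change Ll f _ = some _
      rw [Ll_eq]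
      exact ⟨by rw [h.1]; exact congrArg _ hw.symm, rfl⟩
  · intro x y x' y' hx hy h
    change Ll f _ = some _ at hx hy
    rw [Ll_eq] at hx hy
    exact hf _ _ _ _ hx.1 hy.1 h

theorem PP_mul {k m : ℕ} {f g : Fin k × Fin m ≃. Fin k × Fin m} (hf : f ∈ PP k m)
    (hg : g ∈ PP k m) : f * g ∈ PP k m := by
  constructor
  · intro x y h
    obtain ⟨u, hu, hy⟩ := (mul_eq_some f g x y).1 h
    obtain ⟨f1, f2, f3⟩ := hf.1 x u hu
    obtain ⟨g1, g2, g3⟩ := hg.1 u y hy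
    refine ⟨?_, ?_, ?_⟩
    · intro z hz
      obtain ⟨w, hw⟩ := Option.isSome_iff_exists.1 (f1 z hz)
      obtain ⟨v, hv⟩ := Option.isSome_iff_exists.1 (g1 w (f2 z w hw hz))
      rw [(mul_eq_some f g z v).2 ⟨w, hw, hv⟩]; rfl
    · intro z w hw hz
      obtain ⟨v, hv, hv'⟩ := (mul_eq_some f g z w).1 hw
      exact g2 v w hv' (f2 z v hv hz)
    · intro w hw
      obtain ⟨v, hv, hv'⟩ := g3 w hw
      obtain ⟨z, hz, hz'⟩ := f3 v hv
      exact ⟨z, hz, (mul_eq_some f g z w).2 ⟨v, hz', hv'⟩⟩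
  · intro x y x' y' hx hy h
    obtain ⟨u, hu, hu'⟩ := (mul_eq_some f g x x').1 hx
    obtain ⟨v, hv, hv'⟩ := (mul_eq_some f g y y').1 hy
    exact hg.2 _ _ _ _ hu' hv' (hf.2 _ _ _ _ hu hv h)

theorem PP_factor {k m : ℕ} (hm : 2 ≤ m) {f : Fin k × Fin m ≃. Fin k × Fin m} (hf : f ∈ PP k m) :
    ∃ s φ, OP φ ∧ f = Uu s * Ll φ := by
  obtain ⟨hst, hop⟩ := hf
  let o : Fin m := ⟨0, by omega⟩
  let φ : Fin k ≃. Fin k :=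
    { toFun := fun i => (f (i, o)).map Prod.fst
      invFun := fun j => (f.symm (j, o)).map Prod.fst
      inv := by
        intro a b
        simp only [Option.map_eq_some_iff, PEquiv.eq_some_iff]
        constructor
        · rintro ⟨z, hz, rfl⟩
          obtain ⟨h1, h2, -⟩ := hst _ _ hz
          obtain ⟨w, hw⟩ := Option.isSome_iff_exists.1 (h1 (z.1, o) rfl)
          exact ⟨w, hw, h2 _ _ hw rfl⟩
        · rintro ⟨z, hz, rfl⟩
          obtain ⟨-, -, h3⟩ := hst _ _ hz
          obtain ⟨w, hw, hw'⟩ := h3 (z.1, o) rfl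
          exact ⟨w, hw', hw⟩ }
  have hφ : ∀ i j, φ i = some j ↔ ∃ y, f (i, o) = some (j, y) := by
    intro i j
    change Option.map _ _ = some _ ↔ _
    rw [Option.map_eq_some_iff]
    constructor
    · rintro ⟨z, hz, rfl⟩; exact ⟨_, hz⟩
    · rintro ⟨y, hy⟩; exact ⟨_, hy, rfl⟩
  have hs : ∀ i, ∃ p : Equiv.Perm (Fin m), ∀ x j y, f (i, x) = some (j, y) →
      p y = x := by
    intro i
    by_cases hi : ∃ j, φ i = some j
    · obtain ⟨j, hj⟩ := hi
      obtain ⟨y, hy⟩ := (hφ i j).1 hj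
      obtain ⟨h1, h2, h3⟩ := hst _ _ hy
      have : ∀ x, ∃ y, f (i, x) = some (j, y) := by
        intro x
        obtain ⟨w, hw⟩ := Option.isSome_iff_exists.1 (h1 (i, x) rfl)
        have e : w.1 = j := h2 _ _ hw rfl
        subst e
        exact ⟨_, hw⟩
      choose g hg using this
      have gi : Function.Injective g := by
        intro a b hab
        have := pinj f (hg a) (by rw [hg b, hab])
        simpa using this
      refine ⟨(Equiv.ofBijective g (Finite.injective_iff_bijective.1 gi)).symm, ?_⟩
      intro x j' y h
      rw [Equiv.symm_apply_eq]
      rw [hg] at h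
      simp at h
      exact h.2.symm
    · refine ⟨1, fun x j y h => (hi ?_).elim⟩
      obtain ⟨h1, h2, h3⟩ := hst _ _ h
      obtain ⟨w, hw⟩ := Option.isSome_iff_exists.1 (h1 (i, o) rfl)
      exact ⟨w.1, (hφ _ _).2 ⟨w.2, hw⟩⟩
  choose s hs using hs
  refine ⟨s, φ, ?_, ?_⟩
  · intro x y x' y' hx hy h
    obtain ⟨u, hu⟩ := (hφ _ _).1 hx
    obtain ⟨v, hv⟩ := (hφ _ _).1 hy
    exact hop _ _ _ _ hu hv h
  · apply pext
    rintro ⟨a, b⟩ ⟨c, d⟩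
    rw [mul_eq_some]
    simp only [Uu_apply, Ll_eq, hφ]
    constructor
    · intro h
      refine ⟨_, rfl, ?_, ?_⟩
      · obtain ⟨h1, h2, h3⟩ := hst _ _ h
        obtain ⟨w, hw⟩ := Option.isSome_iff_exists.1 (h1 (a, o) rfl)
        have e : w.1 = c := h2 _ _ hw rfl
        subst e
        exact ⟨_, hw⟩
      · rw [Equiv.Perm.eq_inv_iff_eq]
        exact hs _ _ _ _ h
    · rintro ⟨q, hq, ⟨y, hy⟩, h2⟩
      cases hq
      obtain ⟨h1, h2', h3⟩ := hst _ _ hy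
      obtain ⟨w, hw⟩ := Option.isSome_iff_exists.1 (h1 (a, b) rfl)
      obtain ⟨w1, w2⟩ := w
      have e : w1 = c := h2' _ _ hw rfl
      subst e
      have := hs _ _ _ _ hw
      simp only at h2
      rw [Equiv.Perm.eq_inv_iff_eq, ← this] at h2
      rw [(s a).injective h2]
      exact hw

theorem PP_total {k m : ℕ} (hm : 2 ≤ m) {f : Fin k × Fin m ≃. Fin k × Fin m} (hf : f ∈ PP k m)
    (h : ∀ p, (f p).isSome) : ∃ s, f = Uu s := by
  obtain ⟨s, φ, hφ, rfl⟩ := PP_factor hm hf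
  refine ⟨s, ?_⟩
  rw [OP_total hφ, map_one, mul_one]
  intro i
  obtain ⟨q, hq⟩ := Option.isSome_iff_exists.1 (h (i, ⟨0, by omega⟩))
  obtain ⟨b, hb, hb'⟩ := (mul_eq_some _ _ _ _).1 hq
  rw [Uu_apply] at hb
  cases hb
  rw [Ll_eq] at hb'
  rw [hb'.1]; rfl

theorem PP_total' {k m : ℕ} (hm : 2 ≤ m) {f : Fin k × Fin m ≃. Fin k × Fin m} (hf : f ∈ PP k m)
    (h : ∀ p, (f.symm p).isSome) : ∃ s, f = Uu s := by
  obtain ⟨s, φ, hφ, rfl⟩ := PP_factor hm hf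
  refine ⟨s, ?_⟩
  have : φ.symm = 1 := by
    refine OP_total hφ.symm fun i => ?_
    obtain ⟨q, hq⟩ := Option.isSome_iff_exists.1 (h (i, ⟨0, by omega⟩))
    rw [PEquiv.eq_some_iff] at hq
    obtain ⟨b, hb, hb'⟩ := (mul_eq_some _ _ _ _).1 hq
    rw [Ll_eq] at hb'
    rw [(PEquiv.eq_some_iff φ).2 hb'.1]; rfl
  have : φ = 1 := by
    rw [← PEquiv.symm_symm φ, this]; rfl
  rw [this, map_one, mul_one]

/-- image misses exactly block j -/
def Miss {k m : ℕ} (j : Fin k) (f : Fin k × Fin m ≃. Fin k × Fin m) : Prop :=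
  ∀ p, (f.symm p).isSome ↔ p.1 ≠ j

theorem lower {K m : ℕ} (hm : 2 ≤ m) (G : Set (Fin (K+1) × Fin m ≃. Fin (K+1) × Fin m))
    (hG : (Submonoid.closure G : Set _) = PP (K+1) m) : 2 * (K+1) ≤ G.ncard := by
  classical
  have hmem : ∀ f, f ∈ Submonoid.closure G ↔ f ∈ PP (K+1) m := fun f => by
    rw [← hG]; rfl
  -- units
  have hT : Submonoid.closure (Uu ⁻¹' G) = ⊤ := by
    rw [eq_top_iff]
    intro s _
    have key : ∀ f ∈ Submonoid.closure G, ∀ s, f = Uu s → s ∈ Submonoid.closure (Uu ⁻¹' G) := by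
      intro f hf
      induction hf using Submonoid.closure_induction with
      | mem f hf => rintro s rfl; exact Submonoid.subset_closure hf
      | one =>
        intro s hs
        rw [← map_one Uu] at hs
        rw [← Uu_inj hs]
        exact one_mem _
      | mul f g hf hg ihf ihg =>
        intro s hs
        obtain ⟨a, ha⟩ := PP_total hm ((hmem f).1 hf) (by
          intro p
          have := Uu_apply s p
          rw [← hs, mul_eq_some] at this
          obtain ⟨b, hb, -⟩ := this
          rw [hb]; rfl)
        have hg' : g = Uu (a⁻¹ * s) := by
          rw [map_mul, ← hs, ha, ← mul_assoc, ← map_mul]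
          simp
        have := mul_mem (ihf a ha) (ihg _ hg')
        simpa using this
    exact key _ ((hmem _).2 (Uu_mem s)) s rfl
  have h1 := card_le_of_gen (K+1) m hm _ hT
  have h2 : ∀ j : Fin (K+1), ∃ g ∈ G, Miss j g := by
    intro j
    have key : ∀ f ∈ Submonoid.closure G, Miss j f → ∃ g ∈ G, Miss j g := by
      intro f hf
      induction hf using Submonoid.closure_induction with
      | mem f hf => intro h; exact ⟨f, hf, h⟩
      | one =>
        intro h
        exact ((h (j, ⟨0, by omega⟩)).1 rfl rfl).elim
      | mul f g hf hg ihf ihg =>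
        intro h
        have hsub : ∀ p : Fin (K+1) × Fin m, p.1 ≠ j → (g.symm p).isSome := by
          intro p hp
          obtain ⟨q, hq⟩ := Option.isSome_iff_exists.1 ((h p).2 hp)
          rw [PEquiv.eq_some_iff, mul_eq_some] at hq
          obtain ⟨b, -, hb⟩ := hq
          rw [(PEquiv.eq_some_iff g).2 hb]; rfl
        by_cases hx : ∃ x, (g.symm (j, x)).isSome
        · obtain ⟨x, hx⟩ := hx
          obtain ⟨z, hz⟩ := Option.isSome_iff_exists.1 hx
          rw [PEquiv.eq_some_iff] at hz
          obtain ⟨b, rfl⟩ := PP_total' hm ((hmem g).1 hg) (by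
            intro p
            by_cases hp : p.1 = j
            · obtain ⟨w, -, hw⟩ := (((hmem g).1 hg).1 _ _ hz).2.2 p hp
              rw [(PEquiv.eq_some_iff g).2 hw]; rfl
            · exact hsub p hp)
          apply ihf
          intro p
          have := h (p.1, (b p.1)⁻¹ p.2)
          rw [← this, Option.isSome_iff_exists, Option.isSome_iff_exists]
          simp only [PEquiv.eq_some_iff, mul_eq_some, Uu_apply]
          constructor
          · rintro ⟨a, ha⟩; exact ⟨a, p, ha, rfl⟩
          · rintro ⟨a, q, ha, hq⟩
            have : q = p := by
              obtain ⟨q1, q2⟩ := q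
              obtain ⟨p1, p2⟩ := p
              simp only [Option.some.injEq, Prod.mk.injEq] at hq
              obtain ⟨rfl, hq⟩ := hq
              rw [(b q1)⁻¹.injective hq]
            subst this
            exact ⟨a, ha⟩
        · apply ihg
          intro p
          refine ⟨?_, hsub p⟩
          rintro hp rfl
          exact hx ⟨p.2, hp⟩
    refine key (Ll (alp j j)) ((hmem _).2 (Ll_mem _ (OP_alp _ _))) ?_
    intro p
    rw [Option.isSome_iff_exists]
    simp only [PEquiv.eq_some_iff, Ll_eq, alp_self]
    constructor
    · rintro ⟨a, ⟨h, h'⟩, -⟩; rwa [← h']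
    · intro h; exact ⟨p, ⟨h, rfl⟩, rfl⟩
  choose g hgG hgM using h2
  have gi : Function.Injective g := by
    intro a b hab
    by_contra hne
    have := (hgM a (b, ⟨0, by omega⟩)).2 (Ne.symm hne)
    rw [hab] at this
    exact (hgM b (b, ⟨0, by omega⟩)).1 this rfl
  have fin : ∀ S : Set (Fin (K+1) × Fin m ≃. Fin (K+1) × Fin m), S.Finite := by
    intro S
    have : Finite (Fin (K+1) × Fin m ≃. Fin (K+1) × Fin m) :=
      Finite.of_injective (fun f : (Fin (K+1) × Fin m ≃. Fin (K+1) × Fin m) => (f : _ → _))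
        DFunLike.coe_injective
    exact Set.toFinite _
  have hdis : Disjoint (Uu '' (Uu ⁻¹' G)) (Set.range g) := by
    rw [Set.disjoint_left]
    rintro _ ⟨s, -, rfl⟩ ⟨j, hj⟩
    have := hgM j (j, ⟨0, by omega⟩)
    rw [hj, Uu_symm_apply] at this
    simp at this
  have hsub : Uu '' (Uu ⁻¹' G) ∪ Set.range g ⊆ G := by
    rintro x (⟨s, hs, rfl⟩ | ⟨j, rfl⟩)
    · exact hs
    · exact hgG j
  have := Set.ncard_le_ncard hsub (fin G)
  rw [Set.ncard_union_eq hdis (fin _) (fin _), Set.ncard_image_of_injective _ Uu_inj,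
    ← Set.image_univ, Set.ncard_image_of_injective _ gi, Set.ncard_univ, Nat.card_eq_fintype_card,
    Fintype.card_fin] at this
  omega

theorem upper {K m : ℕ} (hK : 2 ≤ K + 1) (hm : 2 ≤ m) :
    ∃ G : Set (Fin (K+1) × Fin m ≃. Fin (K+1) × Fin m),
      (Submonoid.closure G : Set _) = PP (K+1) m ∧ G.ncard = 2 * (K+1) := by
  obtain ⟨g, hg⟩ := exists_gen_pi (K+1) m hK hm
  let G : Set (Fin (K+1) × Fin m ≃. Fin (K+1) × Fin m) :=
    Set.range (fun i => Uu (g i)) ∪ Set.range (fun i : Fin (K+1) => Ll (alp i (i+1)))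
  have hGc : (Submonoid.closure G : Set _) = PP (K+1) m := by
    apply Set.Subset.antisymm
    · intro f hf
      induction hf using Submonoid.closure_induction with
      | mem f hf =>
        rcases hf with ⟨i, rfl⟩ | ⟨i, rfl⟩
        · exact Uu_mem _
        · exact Ll_mem _ (OP_alp _ _)
      | one => rw [← map_one Uu]; exact Uu_mem _
      | mul f g _ _ hf hg => exact PP_mul hf hg
    · intro f hf
      obtain ⟨s, φ, hφ, rfl⟩ := PP_factor hm hf
      refine mul_mem ?_ ?_
      · have : Submonoid.closure (Set.range g) ≤ (Submonoid.closure G).comap Uu := by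
          rw [Submonoid.closure_le]
          rintro _ ⟨i, rfl⟩
          exact Submonoid.subset_closure (Or.inl ⟨i, rfl⟩)
        rw [hg] at this
        exact this (Submonoid.mem_top s)
      · exact OP_mem ((Submonoid.closure G).comap Ll)
          (fun i => Submonoid.subset_closure (Or.inr ⟨i, rfl⟩)) φ hφ
  refine ⟨G, hGc, le_antisymm ?_ (lower hm G hGc)⟩
  refine (Set.ncard_union_le _ _).trans ?_
  have h1 : ∀ h : Fin (K+1) → (Fin (K+1) × Fin m ≃. Fin (K+1) × Fin m),
      (Set.range h).ncard ≤ K + 1 := by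
    intro h
    rw [← Set.image_univ]
    refine (Set.ncard_image_le Set.finite_univ).trans ?_
    rw [Set.ncard_univ, Nat.card_eq_fintype_card, Fintype.card_fin]
  have := h1 (fun i => Uu (g i))
  have := h1 (fun i : Fin (K+1) => Ll (alp i (i+1)))
  omega

def conj {α β : Type*} (e : α ≃ β) : (α ≃. α) ≃* (β ≃. β) where
  toFun f :=
    { toFun := fun b => (f (e.symm b)).map e
      invFun := fun b => (f.symm (e.symm b)).map e
      inv := by
        intro a b
        simp only [Option.map_eq_some_iff, ← Equiv.eq_symm_apply]
        simp [PEquiv.eq_some_iff] }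
  invFun f :=
    { toFun := fun b => (f (e b)).map e.symm
      invFun := fun b => (f.symm (e b)).map e.symm
      inv := by
        intro a b
        simp only [Option.map_eq_some_iff, Equiv.symm_apply_eq]
        simp [PEquiv.eq_some_iff] }
  left_inv f := by
    apply PEquiv.ext
    intro x
    change Option.map _ (Option.map _ _) = _
    simp
  right_inv f := by
    apply PEquiv.ext
    intro x
    change Option.map _ (Option.map _ _) = _
    simp
  map_mul' f g := by
    apply pext
    intro x y
    rw [mul_eq_some]
    change Option.map _ _ = some _ ↔ ∃ b, Option.map _ _ = some _ ∧ Option.map _ _ = some _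
    simp only [Option.map_eq_some_iff, mul_eq_some]
    constructor
    · rintro ⟨a, ⟨b, h1, h2⟩, rfl⟩
      exact ⟨e b, ⟨b, h1, rfl⟩, a, by simpa using h2, rfl⟩
    · rintro ⟨_, ⟨b, h1, rfl⟩, a, h2, rfl⟩
      exact ⟨a, ⟨b, h1, by simpa using h2⟩, rfl⟩

theorem conj_eq {α β : Type*} (e : α ≃ β) (f : α ≃. α) (x y : α) :
    conj e f (e x) = some (e y) ↔ f x = some y := by
  change Option.map _ _ = some _ ↔ _
  simp

theorem conj_isSome {α β : Type*} (e : α ≃ β) (f : α ≃. α) (x : α) :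
    (conj e f (e x)).isSome ↔ (f x).isSome := by
  change (Option.map _ _).isSome ↔ _
  simp

theorem conj_mem {α β : Type*} {k : ℕ} (e : α ≃ β) (i : α → Fin k) (j : β → Fin k)
    (h : ∀ x, j (e x) = i x) (f : α ≃. α) : conj e f ∈ POISet j ↔ f ∈ POISet i := by
  simp only [POISet, Set.mem_ofPred_eq, PStable, POrdPres, Option.mem_def, e.surjective.forall,
    e.surjective.exists, conj_eq, conj_isSome, h]

/-- for `k, m ≥ 2`, the rank (minimum size of a generating set) of the monoid
`POI_{k×m}` equals `2k`. -/
theorem stmt19 (k m : ℕ) (hk : 2 ≤ k) (hm : 2 ≤ m) :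
    IsLeast {r : ℕ | ∃ G : Set (Fin (k * m) ≃. Fin (k * m)),
      (Submonoid.closure G : Set (Fin (k * m) ≃. Fin (k * m))) = POIkm k m ∧
      Set.ncard G = r} (2 * k) := by
  obtain ⟨K, rfl⟩ : ∃ K, k = K + 1 := ⟨k - 1, by omega⟩
  let e : Fin (K+1) × Fin m ≃ Fin ((K+1) * m) := finProdFinEquiv
  have he : ∀ p : Fin (K+1) × Fin m, blk (K+1) m (e p) = p.1 := by
    rintro ⟨a, b⟩
    apply Fin.ext
    change ((b : ℕ) + m * a) / m = a
    rw [Nat.add_mul_div_left _ _ (by omega), Nat.div_eq_of_lt b.isLt, zero_add]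
  have hc := conj_mem e (fun p => p.1) (blk (K+1) m) he
  have himg : conj e '' PP (K+1) m = POIkm (K+1) m := by
    ext f
    constructor
    · rintro ⟨g, hg, rfl⟩; exact (hc g).2 hg
    · intro hf
      obtain ⟨g, rfl⟩ := (conj e).surjective f
      exact ⟨g, (hc g).1 hf, rfl⟩
  have hcl : ∀ G : Set (Fin (K+1) × Fin m ≃. Fin (K+1) × Fin m),
      (Submonoid.closure (conj e '' G) : Set _) = conj e '' (Submonoid.closure G : Set _) := by
    intro G
    rw [← MonoidHom.map_mclosure (conj e) G]
    rfl
  constructor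
  · obtain ⟨G, hG, hG'⟩ := upper hk hm
    refine ⟨conj e '' G, ?_, ?_⟩
    · rw [hcl, hG, himg]
    · rw [Set.ncard_image_of_injective _ (conj e).injective, hG']
  · rintro r ⟨G, hG, rfl⟩
    obtain ⟨G', rfl⟩ : ∃ G', G = conj e '' G' :=
      ⟨conj e ⁻¹' G, (Set.image_preimage_eq _ (conj e).surjective).symm⟩
    rw [Set.ncard_image_of_injective _ (conj e).injective]
    apply lower hm
    rw [hcl, ← himg] at hG
    exact (conj e).injective.image_injective hG

end POIPaper
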